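/- Let A be a C*-algebra and I a closed two-sided ideal in A with annihilator I⊥ = {a ∈ A : aI = Ia = 0}. Identifying Prim(I) with the open subset {J ∈ Prim(A) : I ⊄ J} of Prim(A), a primitive ideal J ∈ Prim(A) lies in the topological boundary of Prim(I) if and only if I + I⊥ ⊆ J. -/

import Mathlib

/-- A representation of a C*-algebra `A` on a Hilbert space. -/
structure HilbertRep (A : Type) [NonUnitalNormedRing A] [StarRing A]
    [NormedSpace ℂ A] [IsScalarTower ℂ A A] [SMulCommClass ℂ A A] where
  carrier : Type
  [ng : NormedAddCommGroup carrier]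
  [ip : InnerProductSpace ℂ carrier]
  [cs : CompleteSpace carrier]
  π : A →⋆ₙₐ[ℂ] (carrier →L[ℂ] carrier)

attribute [instance] HilbertRep.ng HilbertRep.ip HilbertRep.cs

variable {A : Type} [NonUnitalNormedRing A] [StarRing A] [CStarRing A]
  [NormedSpace ℂ A] [IsScalarTower ℂ A A] [SMulCommClass ℂ A A]
  [StarModule ℂ A] [CompleteSpace A]

/-- A representation is (topologically) irreducible if it is nonzero and has
no nontrivial closed invariant subspaces. -/
def HilbertRep.IsIrreducible (ρ : HilbertRep A) : Prop :=
  ρ.π ≠ 0 ∧ ∀ V : Submodule ℂ ρ.carrier, IsClosed (V : Set ρ.carrier) →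
    (∀ a : A, ∀ v ∈ V, ρ.π a v ∈ V) → V = ⊥ ∨ V = ⊤

/-- A subset of `A` is a primitive ideal if it is the kernel of an irreducible
representation on some Hilbert space. -/
def IsPrimitive (P : Set A) : Prop :=
  ∃ ρ : HilbertRep A, ρ.IsIrreducible ∧ P = {a : A | ρ.π a = 0}

/-- The primitive ideal space of `A`. -/
def PrimSpace (A : Type) [NonUnitalNormedRing A] [StarRing A] [CStarRing A]
    [NormedSpace ℂ A] [IsScalarTower ℂ A A] [SMulCommClass ℂ A A]
    [StarModule ℂ A] [CompleteSpace A] : Type :=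
  {P : Set A // IsPrimitive P}

/-- The Jacobson (hull-kernel) topology on the primitive ideal space: the open
sets are generated by the complements of hulls of subsets. -/
instance : TopologicalSpace (PrimSpace A) :=
  TopologicalSpace.generateFrom
    {U : Set (PrimSpace A) | ∃ S : Set A, U = {J : PrimSpace A | ¬ S ⊆ J.1}}

open scoped Pointwise

/-- The annihilator `I⊥ = {a : aI = Ia = 0}` of an ideal `I`. -/
def annihilatorSet (I : TwoSidedIdeal A) : Set A :=
  {a : A | ∀ b ∈ I, a * b = 0 ∧ b * a = 0}

section StateHelpers

open scoped ComplexOrder InnerProductSpace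

/-- The state space of a unital C*-algebra, as a set of functions. -/
def stateFuns (B : Type) [CStarAlgebra B] [PartialOrder B] : Set (B → ℂ) :=
  {f | (∀ x y, f (x + y) = f x + f y) ∧ (∀ (c : ℂ) x, f (c • x) = c * f x) ∧
    (∀ x, 0 ≤ x → 0 ≤ f x) ∧ f 1 = 1}

/-- The positive linear map attached to a state. -/
noncomputable def stateMap {B : Type} [CStarAlgebra B] [PartialOrder B] [StarOrderedRing B]
    (f : B → ℂ) (hf : f ∈ stateFuns B) : B →ₚ[ℂ] ℂ :=
  PositiveLinearMap.mk₀ { toFun := f, map_add' := hf.1, map_smul' := hf.2.1 } hf.2.2.1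

theorem stateMap_apply {B : Type} [CStarAlgebra B] [PartialOrder B] [StarOrderedRing B]
    (f : B → ℂ) (hf : f ∈ stateFuns B) (x : B) : stateMap f hf x = f x := rfl

theorem stateFuns_bound {B : Type} [CStarAlgebra B] [PartialOrder B] [StarOrderedRing B]
    (f : B → ℂ) (hf : f ∈ stateFuns B) (x : B) : ‖f x‖ ≤ 4 * ‖x‖ := by
  obtain ⟨y, hy_nonneg, hy_norm, hy⟩ := CStarAlgebra.exists_sum_four_nonneg x
  rw [← stateMap_apply f hf]
  conv_lhs => rw [hy]
  simp only [map_sum, map_smul]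
  apply norm_sum_le _ _ |>.trans
  simp only [norm_smul, norm_pow, Complex.norm_I, one_pow, one_mul]
  apply Finset.sum_le_sum (g := fun _ ↦ ‖x‖) (fun i _ ↦ ?_) |>.trans <| by simp
  refine ((stateMap f hf).norm_apply_le_of_nonneg _ (hy_nonneg i)).trans ?_
  rw [stateMap_apply, hf.2.2.2]
  simpa using hy_norm i

theorem stateFuns_isCompact (B : Type) [CStarAlgebra B] [PartialOrder B] [StarOrderedRing B] :
    IsCompact (stateFuns B) := by
  have hK : IsCompact (Set.univ.pi fun x : B => Metric.closedBall (0 : ℂ) (4 * ‖x‖)) :=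
    isCompact_univ_pi fun x => isCompact_closedBall _ _
  refine hK.of_isClosed_subset ?_ ?_
  · have h1 : IsClosed {f : B → ℂ | ∀ x y, f (x + y) = f x + f y} := by
      simp only [Set.setOf_forall]
      exact isClosed_iInter fun x => isClosed_iInter fun y =>
        isClosed_eq (by fun_prop) (by fun_prop)
    have h2 : IsClosed {f : B → ℂ | ∀ (c : ℂ) x, f (c • x) = c * f x} := by
      simp only [Set.setOf_forall]
      exact isClosed_iInter fun x => isClosed_iInter fun y =>
        isClosed_eq (by fun_prop) (by fun_prop)
    have h3 : IsClosed {f : B → ℂ | ∀ x, 0 ≤ x → 0 ≤ f x} := by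
      simp only [Set.setOf_forall]
      exact isClosed_iInter fun x => isClosed_iInter fun _ =>
        isClosed_le (by fun_prop) (by fun_prop)
    have h4 : IsClosed {f : B → ℂ | f 1 = 1} := isClosed_eq (by fun_prop) (by fun_prop)
    exact h1.inter (h2.inter (h3.inter h4))
  · intro f hf x _
    simpa using stateFuns_bound f hf x

theorem stateFuns_convex (B : Type) [CStarAlgebra B] [PartialOrder B] :
    Convex ℝ (stateFuns B) := by
  intro f hf g hg s t hs ht hst
  obtain ⟨f1, f2, f3, f4⟩ := hf
  obtain ⟨g1, g2, g3, g4⟩ := hg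
  refine ⟨fun x y => ?_, fun c x => ?_, fun x hx => ?_, ?_⟩
  · simp [f1, g1]; ring
  · simp [f2, g2]; ring
  · exact add_nonneg (smul_nonneg hs (f3 x hx)) (smul_nonneg ht (g3 x hx))
  · simp [f4, g4]; exact_mod_cast hst

/-- A nonzero positive element is seen by some state. -/
theorem exists_state_ne_zero {B : Type} [CStarAlgebra B] [PartialOrder B] [StarOrderedRing B]
    (a : B) (ha : 0 ≤ a) (ha0 : a ≠ 0) : ∃ f ∈ stateFuns B, f a ≠ 0 := by
  have hna : -a ∉ Set.Ici (0 : B) := by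
    intro h
    exact ha0 (le_antisymm (neg_nonneg.mp h) ha)
  obtain ⟨φ, u, h1, h2⟩ := RCLike.geometric_hahn_banach_point_closed (𝕜 := ℂ)
    (convex_Ici (𝕜 := ℝ) (0 : B)) CStarAlgebra.isClosed_nonneg hna
  have hu : u < 0 := by simpa using h2 0 (by simp)
  have hpos : ∀ x : B, 0 ≤ x → 0 ≤ (φ x).re := by
    intro x hx
    by_contra! hlt
    have h := h2 ((u / (φ x).re) • x) (by
      exact smul_nonneg (div_nonneg_of_nonpos hu.le hlt.le) hx)
    rw [← Complex.coe_smul, map_smul] at h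
    simp [div_mul_cancel₀ _ hlt.ne] at h
  have hapos : 0 < (φ a).re := by
    have : -(φ a).re < u := by simpa using h1
    linarith
  -- symmetrise
  let g : B → ℂ := fun x => (φ x + star (φ (star x))) / 2
  have g1 : ∀ x y, g (x + y) = g x + g y := fun x y => by simp [g]; ring
  have g2 : ∀ (c : ℂ) x, g (c • x) = c * g x := fun c x => by simp [g]; ring
  have gsa : ∀ x, 0 ≤ x → g x = ((φ x).re : ℂ) := fun x hx => by
    have : star x = x := (IsSelfAdjoint.of_nonneg hx).star_eq
    simp only [g, this]
    apply Complex.ext <;> simp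
  have h1pos : 0 < (φ 1).re := by
    have hle : a ≤ algebraMap ℝ B ‖a‖ := (IsSelfAdjoint.of_nonneg ha).le_algebraMap_norm_self
    have h := hpos _ (sub_nonneg.mpr hle)
    rw [Algebra.algebraMap_eq_smul_one, ← Complex.coe_smul, map_sub, map_smul] at h
    simp at h
    by_contra! hc
    have := mul_nonpos_of_nonneg_of_nonpos (norm_nonneg a) hc
    linarith
  have hc0 : ((φ 1).re : ℂ) ≠ 0 := by exact_mod_cast h1pos.ne'
  refine ⟨fun x => ((((φ 1).re)⁻¹ : ℝ) : ℂ) * g x, ⟨fun x y => ?_, fun c x => ?_, fun x hx => ?_, ?_⟩, ?_⟩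
  · simp only [g1]; ring
  · simp only [g2]; ring
  · simp only [gsa x hx]
    rw [← Complex.ofReal_mul]
    exact_mod_cast mul_nonneg (inv_nonneg.mpr h1pos.le) (hpos x hx)
  · simp only [gsa 1 zero_le_one]
    push_cast
    exact inv_mul_cancel₀ hc0
  · simp only [gsa a ha]
    rw [← Complex.ofReal_mul]
    exact_mod_cast (mul_pos (inv_pos.mpr h1pos) hapos).ne'

theorem exists_extreme_state_ne_zero {B : Type} [CStarAlgebra B] [PartialOrder B]
    [StarOrderedRing B] (a : B) (ha : 0 ≤ a) (ha0 : a ≠ 0) :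
    ∃ f ∈ (stateFuns B).extremePoints ℝ, f a ≠ 0 := by
  by_contra! hcon
  obtain ⟨f, hf, hfa⟩ := exists_state_ne_zero a ha ha0
  apply hfa
  rw [← closure_convexHull_extremePoints (stateFuns_isCompact B) (stateFuns_convex B)] at hf
  have hcl : IsClosed {f : B → ℂ | f a = 0} := isClosed_eq (by fun_prop) (by fun_prop)
  have hcv : Convex ℝ {f : B → ℂ | f a = 0} := by
    intro f hf g hg s t _ _ _
    simp only [Set.mem_setOf_eq] at hf hg ⊢
    simp [hf, hg]
  exact closure_minimal (convexHull_min (fun f hf => hcon f hf) hcv) hcl hf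

/-- The GNS vector state formula, and irreducibility for extreme states. -/
theorem gns_irreducible {B : Type} [CStarAlgebra B] [PartialOrder B]
    [StarOrderedRing B] (f : B → ℂ) (hf : f ∈ (stateFuns B).extremePoints ℝ)
    (F : B →ₚ[ℂ] ℂ) (hF : ∀ b, F b = f b)
    (V : Submodule ℂ F.GNS) (hV : IsClosed (V : Set F.GNS))
    (hinv : ∀ b : B, ∀ v ∈ V, F.gnsStarAlgHom b v ∈ V) : V = ⊥ ∨ V = ⊤ := by
  set π := F.gnsStarAlgHom with hπ
  let ξ : F.GNS := ((F.toPreGNS 1 : F.PreGNS) : F.GNS)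
  have hξ : ∀ b, π b ξ = ((F.toPreGNS b : F.PreGNS) : F.GNS) := by
    intro b
    simp [hπ, ξ]
  have hfξ : ∀ b, ⟪ξ, π b ξ⟫_ℂ = f b := by
    intro b
    rw [hξ]
    simp only [ξ, UniformSpace.Completion.inner_coe]
    rw [PositiveLinearMap.preGNS_inner_def]
    simp [hF]
  have hadj : ∀ b (v w : F.GNS), ⟪v, π b w⟫_ℂ = ⟪π (star b) v, w⟫_ℂ := by
    intro b v w
    rw [map_star, ContinuousLinearMap.star_eq_adjoint, ContinuousLinearMap.adjoint_inner_left]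
  -- a closed invariant subspace containing `ξ` is everything
  have htop : ∀ W : Submodule ℂ F.GNS, IsClosed (W : Set F.GNS) →
      (∀ b, π b ξ ∈ W) → W = ⊤ := by
    intro W hW h
    rw [eq_top_iff]
    rintro v -
    induction v using UniformSpace.Completion.induction_on with
    | hp => exact hW
    | ih x =>
      have := h (F.ofPreGNS x)
      rw [hξ] at this
      simpa using this
  haveI : CompleteSpace V := hV.completeSpace_coe
  have hperp : ∀ b : B, ∀ v ∈ Vᗮ, π b v ∈ Vᗮ := by
    intro b v hv
    rw [Submodule.mem_orthogonal] at hv ⊢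
    intro w hw
    rw [hadj]
    exact hv _ (hinv _ _ hw)
  obtain ⟨p, hp, q, hq, hpq⟩ : ∃ p ∈ V, ∃ q ∈ Vᗮ, ξ = p + q :=
    V.exists_add_mem_mem_orthogonal ξ
  have hpq0 : ∀ b, ⟪p, π b q⟫_ℂ = 0 := fun b => hperp b q hq p hp
  have hqp0 : ∀ b, ⟪q, π b p⟫_ℂ = 0 := fun b => by
    rw [← inner_conj_symm, hq _ (hinv b p hp), map_zero]
  have hsum : ∀ b, f b = ⟪p, π b p⟫_ℂ + ⟪q, π b q⟫_ℂ := by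
    intro b
    rw [← hfξ, hpq]
    simp only [map_add, inner_add_left, inner_add_right, hpq0, hqp0]
    ring
  have hnorm : ‖p‖ ^ 2 + ‖q‖ ^ 2 = 1 := by
    have h := hsum 1
    rw [hf.1.2.2.2] at h
    simp only [map_one, one_apply_eq_self, inner_self_eq_norm_sq_to_K] at h
    apply Complex.ofReal_injective
    push_cast
    exact h.symm
  by_cases hp0 : p = 0
  · left
    have : Vᗮ = ⊤ := htop _ (Submodule.isClosed_orthogonal V) fun b => by
      rw [hpq, hp0, zero_add]; exact hperp b q hq
    rw [← Submodule.orthogonal_orthogonal V, this, Submodule.top_orthogonal_eq_bot]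
  right
  by_cases hq0 : q = 0
  · exact htop _ hV fun b => by
      rw [hpq, hq0, add_zero]; exact hinv b p hp
  -- vector states
  have hvec : ∀ v : F.GNS, v ≠ 0 →
      (fun b => (((‖v‖ ^ 2)⁻¹ : ℝ) : ℂ) * ⟪v, π b v⟫_ℂ) ∈ stateFuns B := by
    intro v hv
    have hv' : ((‖v‖ : ℝ) : ℂ) ≠ 0 := by exact_mod_cast norm_ne_zero_iff.mpr hv
    refine ⟨fun x y => ?_, fun c x => ?_, fun x hx => ?_, ?_⟩
    · simp only [map_add, add_apply, inner_add_right]; ring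
    · simp only [map_smul, smul_apply, inner_smul_right]; ring
    · obtain ⟨y, rfl⟩ := CStarAlgebra.nonneg_iff_eq_star_mul_self.mp hx
      have : ⟪v, π (star y * y) v⟫_ℂ = ((‖π y v‖ ^ 2 : ℝ) : ℂ) := by
        rw [map_mul, mul_apply_eq_comp, hadj, star_star,
          inner_self_eq_norm_sq_to_K]
        push_cast; rfl
      simp only [this]
      rw [← Complex.ofReal_mul]
      have : 0 ≤ (‖v‖ ^ 2)⁻¹ * ‖π y v‖ ^ 2 := by positivity
      exact_mod_cast this
    · simp only [map_one, one_apply_eq_self, inner_self_eq_norm_sq_to_K]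
      push_cast
      exact inv_mul_cancel₀ (pow_ne_zero 2 hv')
  have hpn : 0 < ‖p‖ ^ 2 := by positivity
  have hqn : 0 < ‖q‖ ^ 2 := by positivity
  have hpC : ((‖p‖ : ℝ) : ℂ) ≠ 0 := by exact_mod_cast norm_ne_zero_iff.mpr hp0
  have hqC : ((‖q‖ : ℝ) : ℂ) ≠ 0 := by exact_mod_cast norm_ne_zero_iff.mpr hq0
  have hseg : f ∈ openSegment ℝ (fun b => (((‖p‖ ^ 2)⁻¹ : ℝ) : ℂ) * ⟪p, π b p⟫_ℂ)
      (fun b => (((‖q‖ ^ 2)⁻¹ : ℝ) : ℂ) * ⟪q, π b q⟫_ℂ) := by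
    refine ⟨‖p‖ ^ 2, ‖q‖ ^ 2, hpn, hqn, hnorm, ?_⟩
    funext b
    rw [hsum b]
    simp only [Pi.add_apply, Pi.smul_apply, Complex.real_smul]
    push_cast
    field_simp
  have heq := hf.2 (hvec p hp0) (hvec q hq0) hseg
  have hkey : ∀ b, ⟪p - (((‖p‖ ^ 2 : ℝ)) : ℂ) • ξ, π b ξ⟫_ℂ = 0 := by
    intro b
    have h := congrFun heq b
    rw [inner_sub_left, inner_smul_left, hfξ]
    conv_lhs => enter [1]; rw [hpq]
    rw [map_add, inner_add_right, hpq0, ← h]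
    simp only [Complex.conj_ofReal]
    push_cast
    field_simp
    ring
  have hz : p - (((‖p‖ ^ 2 : ℝ)) : ℂ) • ξ = 0 := by
    have ht := htop ((ℂ ∙ (p - (((‖p‖ ^ 2 : ℝ)) : ℂ) • ξ))ᗮ) (Submodule.isClosed_orthogonal _)
      fun b => by rw [Submodule.mem_orthogonal_singleton_iff_inner_right]; exact hkey b
    have hm : p - (((‖p‖ ^ 2 : ℝ)) : ℂ) • ξ ∈ (ℂ ∙ (p - (((‖p‖ ^ 2 : ℝ)) : ℂ) • ξ))ᗮ := by
      rw [ht]; trivial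
    rw [Submodule.mem_orthogonal_singleton_iff_inner_right] at hm
    exact inner_self_eq_zero.mp hm
  have hξV : ξ ∈ V := by
    have hm : (((‖p‖ ^ 2 : ℝ)) : ℂ) • ξ ∈ V := by
      rw [← sub_eq_zero.mp hz]; exact hp
    have hne : (((‖p‖ ^ 2 : ℝ)) : ℂ) ≠ 0 := by exact_mod_cast hpn.ne'
    exact (V.smul_mem_iff hne).mp hm
  exact htop _ hV fun b => hinv b _ hξV

theorem gns_apply_ne_zero {B : Type} [CStarAlgebra B] [PartialOrder B]
    [StarOrderedRing B] (f : B → ℂ) (hf : f ∈ stateFuns B) (d : B)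
    (hd : f (star d * d) ≠ 0) : (stateMap f hf).gnsStarAlgHom d ≠ 0 := by
  intro h
  set F := stateMap f hf with hF
  have h1 := congrArg (fun T => T ((F.toPreGNS 1 : F.PreGNS) : F.GNS)) h
  have h2 : ((F.toPreGNS d : F.PreGNS) : F.GNS) = 0 := by simpa using h1
  have h3 : ⟪((F.toPreGNS d : F.PreGNS) : F.GNS), ((F.toPreGNS d : F.PreGNS) : F.GNS)⟫_ℂ = 0 := by
    rw [h2, inner_zero_left]
  rw [UniformSpace.Completion.inner_coe, PositiveLinearMap.preGNS_inner_def] at h3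
  exact hd (by simpa [hF, stateMap_apply] using h3)

end StateHelpers

/-- Irreducible representations separate points. -/
theorem exists_irreducible_ne_zero (d : A) (hd : d ≠ 0) :
    ∃ ρ : HilbertRep A, ρ.IsIrreducible ∧ ρ.π d ≠ 0 := by
  letI : NonUnitalCStarAlgebra A := {}
  letI : PartialOrder (Unitization ℂ A) := CStarAlgebra.spectralOrder _
  haveI : StarOrderedRing (Unitization ℂ A) := CStarAlgebra.spectralOrderedRing _
  have hd' : (d : Unitization ℂ A) ≠ 0 := by
    intro h
    exact hd (Unitization.inr_injective (R := ℂ) (by simpa using h))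
  have hdd : star (d : Unitization ℂ A) * (d : Unitization ℂ A) ≠ 0 :=
    (CStarRing.star_mul_self_ne_zero_iff _).mpr hd'
  obtain ⟨f, hf, hfd⟩ := exists_extreme_state_ne_zero _ (star_mul_self_nonneg _) hdd
  have hne := gns_apply_ne_zero f hf.1 _ hfd
  let σ : A →⋆ₙₐ[ℂ] ((stateMap f hf.1).GNS →L[ℂ] (stateMap f hf.1).GNS) :=
    ((stateMap f hf.1).gnsStarAlgHom : Unitization ℂ A →⋆ₙₐ[ℂ] _).comp
      (Unitization.inrNonUnitalStarAlgHom ℂ A)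
  have hσ : ∀ a, σ a = (stateMap f hf.1).gnsStarAlgHom (a : Unitization ℂ A) := fun a => rfl
  refine ⟨{ carrier := (stateMap f hf.1).GNS, π := σ }, ⟨?_, ?_⟩, hne⟩
  · intro h
    apply hne
    rw [← hσ]
    exact congrArg (fun T : A →⋆ₙₐ[ℂ] ((stateMap f hf.1).GNS →L[ℂ] (stateMap f hf.1).GNS) => T d) h
  · intro V hV hinv
    refine gns_irreducible f hf (stateMap f hf.1) (fun _ => rfl) V hV ?_
    intro b v hv
    induction b using Unitization.ind with
    | inl_add_inr r a =>
      rw [map_add, add_apply]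
      refine V.add_mem ?_ (hinv a v hv)
      have : (Unitization.inl r : Unitization ℂ A) = algebraMap ℂ _ r := rfl
      rw [this, AlgHomClass.commutes, Algebra.algebraMap_eq_smul_one]
      exact V.smul_mem r hv

/-- Primitive ideals are prime. -/
theorem irreducible_prime (ρ : HilbertRep A) (hρ : ρ.IsIrreducible) (a b : A)
    (ha : ρ.π a ≠ 0) (hb : ρ.π b ≠ 0) : ∃ c, ρ.π (a * c * b) ≠ 0 := by
  by_contra! hcon
  let V : Submodule ℂ ρ.carrier :=
    ⨅ c : A, LinearMap.ker (ρ.π (a * c)).toLinearMap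
  have hmem : ∀ u, u ∈ V ↔ ∀ c, ρ.π (a * c) u = 0 := fun u => by simp [V]
  have hcl : IsClosed (V : Set ρ.carrier) := by
    have : (V : Set ρ.carrier) = ⋂ c, {u | ρ.π (a * c) u = 0} := by
      ext u; simp [hmem]
    rw [this]
    exact isClosed_iInter fun c => isClosed_eq (ρ.π (a * c)).continuous continuous_const
  have hinv : ∀ e : A, ∀ v ∈ V, ρ.π e v ∈ V := by
    intro e v hv
    rw [hmem] at hv ⊢
    intro c
    rw [← mul_apply_eq_comp, ← map_mul, mul_assoc]
    exact hv _
  rcases hρ.2 V hcl hinv with h | h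
  · apply hb
    ext v
    have : ρ.π b v ∈ V := by
      rw [hmem]
      intro c
      rw [← mul_apply_eq_comp, ← map_mul, hcon]; rfl
    rw [h] at this
    simpa using this
  · apply ha
    have h1 : ρ.π (a * star a) = 0 := by
      ext v
      exact (hmem v).mp (by rw [h]; trivial) _
    rw [map_mul, map_star] at h1
    exact (CStarRing.mul_star_self_eq_zero_iff _).mp h1

theorem exists_basic_nhd (O : Set (PrimSpace A)) (hO : IsOpen O) :
    ∀ J ∈ O, ∃ c, c ∉ J.1 ∧ ∀ K : PrimSpace A, c ∉ K.1 → K ∈ O := by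
  induction hO with
  | basic U hU =>
    obtain ⟨S, rfl⟩ := hU
    intro J hJ
    obtain ⟨c, hc, hcJ⟩ := Set.not_subset.mp hJ
    exact ⟨c, hcJ, fun K hK => fun h => hK (h hc)⟩
  | univ =>
    rintro ⟨_, ρ, hρ, rfl⟩ -
    have : ∃ c, ρ.π c ≠ 0 := by
      by_contra! h
      exact hρ.1 (by ext c : 1; exact h c)
    obtain ⟨c, hc⟩ := this
    exact ⟨c, hc, fun _ _ => trivial⟩
  | inter U W _ _ h1 h2 =>
    rintro J ⟨hJU, hJW⟩
    obtain ⟨c, hc, hcU⟩ := h1 J hJU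
    obtain ⟨e, he, heW⟩ := h2 J hJW
    obtain ⟨_, ρ, hρ, rfl⟩ := J
    obtain ⟨x, hx⟩ := irreducible_prime ρ hρ c e hc he
    refine ⟨c * x * e, hx, fun K hK => ⟨hcU K ?_, heW K ?_⟩⟩
    · obtain ⟨_, τ, hτ, rfl⟩ := K
      intro h
      have h' : τ.π c = 0 := h
      exact hK (show τ.π (c * x * e) = 0 by simp [map_mul, h'])
    · obtain ⟨_, τ, hτ, rfl⟩ := K
      intro h
      have h' : τ.π e = 0 := h
      exact hK (show τ.π (c * x * e) = 0 by simp [map_mul, h'])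
  | sUnion S _ ih =>
    rintro J ⟨U, hU, hJ⟩
    obtain ⟨c, hc, h⟩ := ih U hU J hJ
    exact ⟨c, hc, fun K hK => ⟨U, hU, h K hK⟩⟩

theorem isOpen_not_subset (S : Set A) : IsOpen {K : PrimSpace A | ¬ S ⊆ K.1} :=
  TopologicalSpace.isOpen_generateFrom_of_mem ⟨S, rfl⟩

/-- Identifying `Prim(I)` with the open subset `{J ∈ Prim(A) : I ⊄ J}`, a
primitive ideal `J` lies in the topological boundary of `Prim(I)` if and only
if `I + I⊥ ⊆ J`. -/
theorem mem_frontier_primOfIdeal_iff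
    (I : TwoSidedIdeal A) (hI : IsClosed (I : Set A)) (J : PrimSpace A) :
    J ∈ frontier {K : PrimSpace A | ¬ (I : Set A) ⊆ K.1} ↔
      (I : Set A) + annihilatorSet I ⊆ J.1 := by
  rw [(isOpen_not_subset (I : Set A)).frontier_eq]
  constructor
  · rintro ⟨hJc, hJI⟩
    have hJI' : (I : Set A) ⊆ J.1 := not_not.mp hJI
    have hann : annihilatorSet I ⊆ J.1 := by
      by_contra hn
      obtain ⟨K, hK1, hK2⟩ := mem_closure_iff.mp hJc _ (isOpen_not_subset (annihilatorSet I)) hn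
      obtain ⟨a, ha, haK⟩ := Set.not_subset.mp hK1
      obtain ⟨b, hb, hbK⟩ := Set.not_subset.mp hK2
      obtain ⟨_, ρ, hρ, rfl⟩ := K
      obtain ⟨c, hc⟩ := irreducible_prime ρ hρ a b haK hbK
      apply hc
      rw [mul_assoc, (ha (c * b) (I.mul_mem_left c b hb)).1, map_zero]
    rintro _ ⟨x, hx, y, hy, rfl⟩
    have hxJ := hJI' hx
    have hyJ := hann hy
    obtain ⟨_, ρ, hρ, rfl⟩ := J
    have hx' : ρ.π x = 0 := hxJ
    have hy' : ρ.π y = 0 := hyJ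
    show ρ.π (x + y) = 0
    rw [map_add, hx', hy', add_zero]
  · intro h
    have hIJ : (I : Set A) ⊆ J.1 := fun x hx =>
      h ⟨x, hx, 0, fun b _ => by simp, by simp⟩
    have hAJ : annihilatorSet I ⊆ J.1 := fun x hx =>
      h ⟨0, I.zero_mem, x, hx, by simp⟩
    refine ⟨mem_closure_iff.mpr fun O hO hJO => ?_, fun hn => hn hIJ⟩
    obtain ⟨c, hcJ, hcO⟩ := exists_basic_nhd O hO J hJO
    have hcA : c ∉ annihilatorSet I := fun hc => hcJ (hAJ hc)
    have : ∃ b ∈ I, c * b ≠ 0 ∨ b * c ≠ 0 := by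
      by_contra! hcon
      exact hcA fun b hb => hcon b hb
    obtain ⟨b, hb, hcb⟩ := this
    have key : ∃ ρ : HilbertRep A, ρ.IsIrreducible ∧ ρ.π c ≠ 0 ∧ ρ.π b ≠ 0 := by
      rcases hcb with hd | hd
      all_goals
        obtain ⟨ρ, hρ, hρd⟩ := exists_irreducible_ne_zero _ hd
        refine ⟨ρ, hρ, fun h0 => hρd ?_, fun h0 => hρd ?_⟩ <;> simp [map_mul, h0]
    obtain ⟨ρ, hρ, hc, hbρ⟩ := key
    exact ⟨⟨_, ρ, hρ, rfl⟩, hcO _ hc, fun hsub => hbρ (hsub hb)⟩
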